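/- Let H : ℝⁿ × ℝⁿ → ℝ be continuous and satisfy (H1), (H2), (H3b), (H4), and assume p ↦ H(x,p) is convex for each x (H5). For each k ∈ ℕ let u_k be the unique Lipschitz state-constraint viscosity solution of u_k(x) + H(x, Du_k(x)) = 0 on B(0,k), and let u be the unique bounded Lipschitz viscosity solution of u(x) + H(x, Du(x)) = 0 in ℝⁿ. Then: (i) u(x) ≤ u_k(x) for every x in the closure of B(0,k); and (ii) there exists a constant C > 0 depending only on H such that u_k(x) ≤ u(x) + C e^{(|x| − k)/C} for each x ∈ B(0,k). In particular, for any fixed R > 0, 0 ≤ u_k(x) − u(x) ≤ (C e^{R/C}) e^{−k/C} for all |x| ≤ R and k > R. -/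

import Mathlib

open Metric Set MeasureTheory Filter
open scoped Topology NNReal RealInnerProductSpace

noncomputable section

abbrev Euc (n : ℕ) := EuclideanSpace ℝ (Fin n)

/-- `v` is a viscosity subsolution of `v + H(x, Dv) = 0` in the open set `Ω`. -/
def IsViscositySubsolutionIn {n : ℕ} (Ω : Set (Euc n)) (H : Euc n → Euc n → ℝ)
    (v : Euc n → ℝ) : Prop :=
  ∀ x ∈ Ω, ∀ φ : Euc n → ℝ, ContDiff ℝ 1 φ →
    IsLocalMaxOn (fun y => v y - φ y) Ω x → v x + H x (gradient φ x) ≤ 0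

/-- `v` is a viscosity supersolution of `v + H(x, Dv) = 0` on the closure of `Ω`. -/
def IsViscositySupersolutionOn {n : ℕ} (Ω : Set (Euc n)) (H : Euc n → Euc n → ℝ)
    (v : Euc n → ℝ) : Prop :=
  ∀ x ∈ closure Ω, ∀ φ : Euc n → ℝ, ContDiff ℝ 1 φ →
    IsLocalMinOn (fun y => v y - φ y) (closure Ω) x → 0 ≤ v x + H x (gradient φ x)

/-- `v` is a state-constraint viscosity solution on `Ω`. -/
def IsStateConstraintSolution {n : ℕ} (Ω : Set (Euc n)) (H : Euc n → Euc n → ℝ)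
    (v : Euc n → ℝ) : Prop :=
  ContinuousOn v (closure Ω) ∧ IsViscositySubsolutionIn Ω H v ∧
    IsViscositySupersolutionOn Ω H v

theorem aux_quad {n : ℕ} (c : ℝ) (a x : Euc n) :
    HasGradientAt (fun y : Euc n => c * ‖y - a‖ ^ 2) ((2 * c) • (x - a)) x := by
  rw [hasGradientAt_iff_hasFDerivAt]
  have h := (((hasFDerivAt_id x).sub_const a).norm_sq).const_mul c
  refine h.congr_fderiv ?_
  ext y
  simp [inner_smul_left]
  ring

theorem aux_quad_smooth {n : ℕ} (c : ℝ) (a : Euc n) :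
    ContDiff ℝ 1 (fun y : Euc n => c * ‖y - a‖ ^ 2) :=
  contDiff_const.mul ((contDiff_id.sub contDiff_const).norm_sq ℝ)

theorem aux_bar_smooth {n : ℕ} (A C k : ℝ) :
    ContDiff ℝ 1 (fun y : Euc n => A * Real.exp ((√(1 + ‖y‖ ^ 2) - k) / C)) := by
  have h : ContDiff ℝ 1 (fun y : Euc n => √(1 + ‖y‖ ^ 2)) :=
    (contDiff_const.add (contDiff_id.norm_sq ℝ)).sqrt (fun x => by positivity)
  exact contDiff_const.mul ((h.sub contDiff_const).div_const C).exp

theorem aux_bar_grad {n : ℕ} (A C k : ℝ) (hA : 0 ≤ A) (hC : 0 < C) (x : Euc n) :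
    ∃ p : Euc n, HasGradientAt (fun y : Euc n => A * Real.exp ((√(1 + ‖y‖ ^ 2) - k) / C)) p x ∧
      ‖p‖ ≤ A * Real.exp ((√(1 + ‖x‖ ^ 2) - k) / C) / C := by
  have hs : 0 < √(1 + ‖x‖ ^ 2) := by positivity
  refine ⟨(A * Real.exp ((√(1 + ‖x‖ ^ 2) - k) / C) / C / √(1 + ‖x‖ ^ 2)) • x, ?_, ?_⟩
  · rw [hasGradientAt_iff_hasFDerivAt]
    have h := ((((((hasFDerivAt_id x).norm_sq).const_add 1).sqrt
      (by simp only [id]; positivity)).sub_const k).mul_const C⁻¹).exp.const_mul A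
    simp only [← div_eq_mul_inv] at h
    refine h.congr_fderiv ?_
    ext y
    simp [inner_smul_left]
    field_simp
  · rw [norm_smul, Real.norm_of_nonneg (by positivity), div_mul_eq_mul_div, div_le_iff₀ hs]
    gcongr
    apply Real.le_sqrt_of_sq_le
    linarith

theorem aux_doubling {n : ℕ} (k : ℝ) (hk : 0 ≤ k) (w u : Euc n → ℝ) (L : ℝ≥0)
    (hw : ContinuousOn w (closedBall 0 k)) (hu : LipschitzWith L u) (c : ℝ) (hc : L < c) :
    ∃ a ∈ closedBall (0 : Euc n) k, ∃ b ∈ ball (0 : Euc n) (k + 1),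
      (∀ z ∈ closedBall (0 : Euc n) k, ∀ y ∈ closedBall (0 : Euc n) (k + 1),
        w z + u y - c * ‖z - y‖ ^ 2 ≤ w a + u b - c * ‖a - b‖ ^ 2) ∧ c * ‖a - b‖ ≤ L := by
  have hc0 : 0 < c := lt_of_le_of_lt L.2 hc
  have hcomp : IsCompact (closedBall (0 : Euc n) k ×ˢ closedBall (0 : Euc n) (k + 1)) :=
    (isCompact_closedBall _ _).prod (isCompact_closedBall _ _)
  have hcont : ContinuousOn (fun q : Euc n × Euc n => w q.1 + u q.2 - c * ‖q.1 - q.2‖ ^ 2)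
      (closedBall (0 : Euc n) k ×ˢ closedBall (0 : Euc n) (k + 1)) := by
    refine ContinuousOn.sub (ContinuousOn.add ?_ ?_) ?_
    · exact hw.comp continuousOn_fst (fun q hq => hq.1)
    · exact (hu.continuous.comp continuous_snd).continuousOn
    · fun_prop
  obtain ⟨⟨a, b⟩, hab, hmax⟩ := hcomp.exists_isMaxOn
    ⟨(0, 0), by simp [hk], by simp; linarith⟩ hcont
  have hmax' : ∀ z ∈ closedBall (0 : Euc n) k, ∀ y ∈ closedBall (0 : Euc n) (k + 1),
        w z + u y - c * ‖z - y‖ ^ 2 ≤ w a + u b - c * ‖a - b‖ ^ 2 :=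
    fun z hz y hy => hmax (show (z, y) ∈ _ from ⟨hz, hy⟩)
  have ha : a ∈ closedBall (0 : Euc n) k := hab.1
  have h1 := hmax' a ha a (closedBall_subset_closedBall (by linarith) ha)
  have h2 : u b - u a ≤ L * ‖a - b‖ := by
    have := hu.dist_le_mul b a
    rw [Real.dist_eq, dist_comm, dist_eq_norm] at this
    exact (le_abs_self _).trans this
  simp at h1
  have h3 : c * ‖a - b‖ ≤ L := by
    rcases (norm_nonneg (a - b)).eq_or_lt with h0 | h0
    · rw [← h0]; simp
    · by_contra! hcon
      nlinarith
  refine ⟨a, ha, b, ?_, hmax', h3⟩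
  have h4 : ‖a - b‖ < 1 := by
    by_contra! hcon
    nlinarith
  rw [mem_ball_zero_iff]
  rw [mem_closedBall_zero_iff] at ha
  have : ‖b‖ ≤ ‖a‖ + ‖a - b‖ := by
    have := norm_sub_le a (a - b); simpa using this
  linarith

theorem aux_bound {n : ℕ} (H : Euc n → Euc n → ℝ) (C₁ : ℝ) (hH1 : ∀ x p : Euc n, -H x p ≤ C₁)
    (k : ℝ) (hk : 0 < k) (v : Euc n → ℝ) (L : ℝ≥0)
    (hsub : IsViscositySubsolutionIn (ball 0 k) H v)
    (hL : LipschitzOnWith L v (closedBall 0 k)) (x : Euc n) (hx : x ∈ closedBall (0 : Euc n) k) :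
    v x ≤ C₁ := by
  have key : ∀ x ∈ ball (0 : Euc n) k, v x ≤ C₁ := by
    intro x hx
    rw [mem_ball_zero_iff] at hx
    set c : ℝ := (L + 1) / (k - ‖x‖) with hcdef
    have hkx : 0 < k - ‖x‖ := by linarith
    have hL0 : (0 : ℝ) ≤ L := L.2
    have hc0 : 0 < c := by positivity
    have hxc : x ∈ closedBall (0 : Euc n) k := by rw [mem_closedBall_zero_iff]; exact hx.le
    have hcont : ContinuousOn (fun y => v y - c * ‖y - x‖ ^ 2) (closedBall (0 : Euc n) k) :=
      hL.continuousOn.sub (by fun_prop)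
    obtain ⟨a, ha, hmax⟩ := (isCompact_closedBall (0 : Euc n) k).exists_isMaxOn ⟨x, hxc⟩ hcont
    have h1 : v x - c * ‖x - x‖ ^ 2 ≤ v a - c * ‖a - x‖ ^ 2 := hmax hxc
    simp at h1
    have h2 : v a - v x ≤ L * ‖a - x‖ := by
      have := hL.dist_le_mul a ha x hxc
      rw [Real.dist_eq, dist_eq_norm] at this
      exact (le_abs_self _).trans this
    have h3 : ‖a - x‖ < k - ‖x‖ := by
      by_contra! hcon
      have e : c * (k - ‖x‖) = L + 1 := by rw [hcdef]; field_simp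
      have : L + 1 ≤ c * ‖a - x‖ := by rw [← e]; gcongr
      nlinarith
    have hab : a ∈ ball (0 : Euc n) k := by
      rw [mem_ball_zero_iff]
      have := norm_add_le (a - x) x
      simp at this
      linarith
    have h4 := hsub a hab _ (aux_quad_smooth c x)
      ((hmax.on_subset ball_subset_closedBall).localize)
    have h5 := hH1 a (gradient (fun y : Euc n => c * ‖y - x‖ ^ 2) a)
    have : 0 ≤ c * ‖a - x‖ ^ 2 := by positivity
    linarith
  have hcl : closure (ball (0 : Euc n) k) = closedBall 0 k := closure_ball _ hk.ne'
  rw [← hcl] at hx hL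
  exact le_on_closure key hL.continuousOn continuousOn_const hx

theorem aux_modulus {n : ℕ} (H : Euc n → Euc n → ℝ)
    (hH3b : ∀ R > (0:ℝ), ∃ ω : ℝ → ℝ, (∀ r, 0 ≤ ω r) ∧ MonotoneOn ω (Ici (0:ℝ)) ∧
      Tendsto ω (𝓝[>] (0:ℝ)) (𝓝 0) ∧
      ∀ x y p q : Euc n, ‖p‖ ≤ R → ‖q‖ ≤ R →
        |H x p - H y p| ≤ ω ‖x - y‖ ∧ |H x p - H x q| ≤ ω ‖p - q‖)
    (R : ℝ) (hR : 0 < R) (η : ℝ) (hη : 0 < η) :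
    ∃ δ > 0, ∀ x y p : Euc n, ‖p‖ ≤ R → ‖x - y‖ < δ → H x p - H y p ≤ η := by
  obtain ⟨ω, -, -, hω, hH⟩ := hH3b R hR
  have h1 : ∀ᶠ r in 𝓝[>] (0:ℝ), ω r < η := hω.eventually_lt_const hη
  rw [eventually_nhdsWithin_iff, Metric.eventually_nhds_iff] at h1
  obtain ⟨δ, hδ, h1⟩ := h1
  refine ⟨δ, hδ, fun x y p hp hxy => ?_⟩
  rcases (norm_nonneg (x - y)).eq_or_lt with h0 | h0
  · have : x = y := by rw [← sub_eq_zero, ← norm_eq_zero]; exact h0.symm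
    subst this; simp [hη.le]
  · have h2 := h1 (y := ‖x - y‖) (by simpa using hxy) h0
    have h3 := (hH x y p p hp hp).1
    exact (le_abs_self _).trans (h3.trans h2.le)

theorem aux_lip {n : ℕ} (H : Euc n → Euc n → ℝ)
    (C₂ : ℝ) (hH2 : ∀ x : Euc n, |H x 0| ≤ C₂)
    (hH3b : ∀ R > (0:ℝ), ∃ ω : ℝ → ℝ, (∀ r, 0 ≤ ω r) ∧ MonotoneOn ω (Ici (0:ℝ)) ∧
      Tendsto ω (𝓝[>] (0:ℝ)) (𝓝 0) ∧
      ∀ x y p q : Euc n, ‖p‖ ≤ R → ‖q‖ ≤ R →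
        |H x p - H y p| ≤ ω ‖x - y‖ ∧ |H x p - H x q| ≤ ω ‖p - q‖)
    (hH5 : ∀ x : Euc n, ConvexOn ℝ univ (H x)) (R : ℝ) (hR : 0 < R) :
    ∃ V : ℝ, 0 ≤ V ∧ ∀ x p q : Euc n, ‖p‖ < R → ‖q‖ < R → H x p - H x q ≤ V * ‖p - q‖ := by
  obtain ⟨ω, -, hmono, -, hH⟩ := hH3b (R + 1) (by linarith)
  refine ⟨((2 * (C₂ + ω (R + 1)) / 1).toNNReal : ℝ), NNReal.coe_nonneg _, fun x p q hp hq => ?_⟩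
  have h := ((hH5 x).subset (subset_univ (ball 0 (R + 1))) (convex_ball _ _)).lipschitzOnWith_of_abs_le
    (M := C₂ + ω (R + 1)) one_pos (fun a ha => by
      rw [dist_zero_right] at ha
      have h1 := (hH x x a 0 ha.le (by simp; linarith)).2
      rw [sub_zero] at h1
      have h2 := hmono (norm_nonneg a) (show (0:ℝ) ≤ R + 1 by linarith) ha.le
      have h3 := hH2 x
      have h4 := abs_add_le (H x a - H x 0) (H x 0)
      rw [sub_add_cancel] at h4
      linarith)
  have h5 := h.dist_le_mul p (by simpa using hp) q (by simpa using hq)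
  rw [Real.dist_eq, dist_eq_norm] at h5
  exact (le_abs_self _).trans h5

/-- Part (i). -/
theorem aux_lower {n : ℕ} (H : Euc n → Euc n → ℝ)
    (hH3b : ∀ R > (0:ℝ), ∃ ω : ℝ → ℝ, (∀ r, 0 ≤ ω r) ∧ MonotoneOn ω (Ici (0:ℝ)) ∧
      Tendsto ω (𝓝[>] (0:ℝ)) (𝓝 0) ∧
      ∀ x y p q : Euc n, ‖p‖ ≤ R → ‖q‖ ≤ R →
        |H x p - H y p| ≤ ω ‖x - y‖ ∧ |H x p - H x q| ≤ ω ‖p - q‖)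
    (k : ℝ) (hk : 0 < k) (v : Euc n → ℝ) (hv : ContinuousOn v (closedBall 0 k))
    (hsup : IsViscositySupersolutionOn (ball 0 k) H v)
    (u : Euc n → ℝ) (L : ℝ≥0) (hu : LipschitzWith L u)
    (hsub : IsViscositySubsolutionIn univ H u)
    (z : Euc n) (hz : z ∈ closedBall (0 : Euc n) k) : u z ≤ v z := by
  have hcl : closure (ball (0 : Euc n) k) = closedBall 0 k := closure_ball _ hk.ne'
  have hL0 : (0 : ℝ) ≤ L := L.2
  refine le_of_forall_pos_le_add fun η hη => ?_
  obtain ⟨δ, hδ, hmod⟩ := aux_modulus H hH3b (2 * L + 1) (by linarith) η hη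
  set c : ℝ := (L + 1) * (1 + 1 / δ) with hcdef
  have hc1 : L < c := by
    have : 0 < (L + 1 : ℝ) * (1 / δ) := by positivity
    rw [hcdef]; linarith
  have hc0 : 0 < c := by linarith
  have hcδ : L < c * δ := by
    have : c * δ = (L + 1) * (δ + 1) := by rw [hcdef]; field_simp
    rw [this]; nlinarith
  obtain ⟨a, ha, b, hb, hmax, hab⟩ := aux_doubling k hk.le (fun x => - v x) u L hv.neg hu c hc1
  have hbc := ball_subset_closedBall hb
  have habδ : ‖a - b‖ < δ := by
    by_contra! hcon
    nlinarith
  have h1 := hsub b (mem_univ b) _ (aux_quad_smooth c a) (by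
    have : ∀ᶠ y in 𝓝[univ] b, y ∈ ball (0 : Euc n) (k + 1) :=
      mem_nhdsWithin_of_mem_nhds (isOpen_ball.mem_nhds hb)
    filter_upwards [this] with y hy
    have := hmax a ha y (ball_subset_closedBall hy)
    rw [norm_sub_rev a y, norm_sub_rev a b] at this
    linarith)
  rw [(aux_quad c a b).gradient] at h1
  have h2 := hsup a (hcl ▸ ha) _ (aux_quad_smooth (-c) b) (by
    rw [hcl]
    filter_upwards [self_mem_nhdsWithin] with y hy
    have := hmax y hy b hbc
    linarith)
  rw [(aux_quad (-c) b a).gradient] at h2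
  have e : (2 * -c) • (a - b) = (2 * c) • (b - a) := by
    rw [← neg_sub a b, smul_neg, mul_neg, neg_smul]
  rw [e] at h2
  have hp : ‖(2 * c) • (b - a)‖ ≤ 2 * L + 1 := by
    rw [norm_smul, Real.norm_of_nonneg (by positivity), norm_sub_rev]
    linarith
  have h3 := hmod a b _ hp habδ
  have h4 := hmax z hz z (closedBall_subset_closedBall (by linarith) hz)
  simp at h4
  have : 0 ≤ c * ‖a - b‖ ^ 2 := by positivity
  linarith

/-- Part (ii), for the smooth barrier. -/
theorem aux_upper {n : ℕ} (H : Euc n → Euc n → ℝ)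
    (C₁ : ℝ) (hH1 : ∀ x p : Euc n, -H x p ≤ C₁)
    (hH3b : ∀ R > (0:ℝ), ∃ ω : ℝ → ℝ, (∀ r, 0 ≤ ω r) ∧ MonotoneOn ω (Ici (0:ℝ)) ∧
      Tendsto ω (𝓝[>] (0:ℝ)) (𝓝 0) ∧
      ∀ x y p q : Euc n, ‖p‖ ≤ R → ‖q‖ ≤ R →
        |H x p - H y p| ≤ ω ‖x - y‖ ∧ |H x p - H x q| ≤ ω ‖p - q‖)
    (L L' : ℝ≥0) (M A R V C : ℝ) (hA : A = C₁ + M) (hA0 : 0 ≤ A)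
    (hR : R = 2 * L' + A * Real.exp 1 + 1)
    (hV : ∀ x p q : Euc n, ‖p‖ < R → ‖q‖ < R → H x p - H x q ≤ V * ‖p - q‖)
    (hV0 : 0 ≤ V) (hC1 : 1 ≤ C) (hCV : V ≤ C)
    (k : ℝ) (hk : 0 < k) (v : Euc n → ℝ) (hv : LipschitzOnWith L v (closedBall 0 k))
    (hsub : IsViscositySubsolutionIn (ball 0 k) H v)
    (u : Euc n → ℝ) (hub : ∀ x, |u x| ≤ M) (hu : LipschitzWith L' u)
    (hsup : IsViscositySupersolutionOn univ H u)
    (z : Euc n) (hz : z ∈ closedBall (0 : Euc n) k) :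
    v z ≤ u z + A * Real.exp ((√(1 + ‖z‖ ^ 2) - k) / C) := by
  have hL0 : (0 : ℝ) ≤ L' := L'.2
  have hC0 : 0 < C := by linarith
  set g : Euc n → ℝ := fun y => A * Real.exp ((√(1 + ‖y‖ ^ 2) - k) / C) with hg
  have hgs : ContDiff ℝ 1 g := aux_bar_smooth A C k
  have hR0 : 0 < R := by rw [hR]; positivity
  refine le_of_forall_pos_le_add fun η hη => ?_
  obtain ⟨δ, hδ, hmod⟩ := aux_modulus H hH3b R hR0 η hη
  set c : ℝ := (L' + 1) * (1 + 1 / δ) with hcdef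
  have hc1 : L' < c := by
    have : 0 < (L' + 1 : ℝ) * (1 / δ) := by positivity
    rw [hcdef]; linarith
  have hc0 : 0 < c := by linarith
  have hcδ : L' < c * δ := by
    have : c * δ = (L' + 1) * (δ + 1) := by rw [hcdef]; field_simp
    rw [this]; nlinarith
  obtain ⟨a, ha, b, hb, hmax, hab⟩ := aux_doubling k hk.le (fun x => v x - g x) (fun x => - u x) L'
    (hv.continuousOn.sub hgs.continuous.continuousOn) hu.neg c hc1
  have hbc := ball_subset_closedBall hb
  have habδ : ‖a - b‖ < δ := by
    by_contra! hcon
    nlinarith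
  have h4 := hmax z hz z (closedBall_subset_closedBall (by linarith) hz)
  simp at h4
  have h5 : 0 ≤ c * ‖a - b‖ ^ 2 := by positivity
  suffices hs : v a - g a - u b ≤ η by
    change v z ≤ u z + g z + η
    linarith
  have han : ‖a‖ ≤ k := by simpa using ha
  rcases han.eq_or_lt with hak | hak
  · have h6 := aux_bound H C₁ hH1 k hk v L hsub hv a ha
    have h7 := (abs_le.1 (hub b)).1
    have h8 : A ≤ g a := by
      have : ‖a‖ ≤ √(1 + ‖a‖ ^ 2) := Real.le_sqrt_of_sq_le (by linarith)
      have : 1 ≤ Real.exp ((√(1 + ‖a‖ ^ 2) - k) / C) :=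
        Real.one_le_exp (div_nonneg (by linarith) hC0.le)
      exact le_mul_of_one_le_right hA0 this
    linarith
  · have hak' : a ∈ ball (0 : Euc n) k := by simpa using hak
    obtain ⟨q, hq, hqn⟩ := aux_bar_grad A C k hA0 hC0 a
    have hgrad : HasGradientAt (fun y => c * ‖y - b‖ ^ 2 + g y) ((2 * c) • (a - b) + q) a := by
      have i1 := (aux_quad c b a).hasFDerivAt
      have i2 := hq.hasFDerivAt
      rw [hasGradientAt_iff_hasFDerivAt, map_add]
      exact i1.add i2
    have h1 := hsub a hak' _ ((aux_quad_smooth c b).add hgs) (by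
      filter_upwards [self_mem_nhdsWithin] with y hy
      have := hmax y (ball_subset_closedBall hy) b hbc
      linarith)
    rw [hgrad.gradient] at h1
    have h2 := hsup b (by simp) _ (aux_quad_smooth (-c) a) (by
      have : ∀ᶠ y in 𝓝[closure univ] b, y ∈ ball (0 : Euc n) (k + 1) :=
        mem_nhdsWithin_of_mem_nhds (isOpen_ball.mem_nhds hb)
      filter_upwards [this] with y hy
      have := hmax a ha y (ball_subset_closedBall hy)
      rw [norm_sub_rev a y, norm_sub_rev a b] at this
      linarith)
    rw [(aux_quad (-c) a b).gradient] at h2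
    have e : (2 * -c) • (b - a) = (2 * c) • (a - b) := by
      rw [← neg_sub a b, smul_neg, mul_neg, neg_smul, neg_neg]
    rw [e] at h2
    have hp : ‖(2 * c) • (a - b)‖ ≤ 2 * L' := by
      rw [norm_smul, Real.norm_of_nonneg (by positivity)]
      linarith
    have hga0 : 0 ≤ g a := by positivity
    have hga : g a ≤ A * Real.exp 1 := by
      have hs1 : √(1 + ‖a‖ ^ 2) ≤ 1 + ‖a‖ := by
        rw [Real.sqrt_le_left (by positivity)]
        nlinarith [norm_nonneg a]
      have : (√(1 + ‖a‖ ^ 2) - k) / C ≤ 1 := by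
        rw [div_le_one hC0]; linarith
      exact mul_le_mul_of_nonneg_left (Real.exp_le_exp.2 this) hA0
    change ‖q‖ ≤ g a / C at hqn
    have hqg : C * ‖q‖ ≤ g a := by rw [le_div_iff₀ hC0] at hqn; linarith
    have hq1 : ‖q‖ ≤ g a := by nlinarith [norm_nonneg q]
    have hAe : 0 ≤ A * Real.exp 1 := by positivity
    have hp2 : ‖(2 * c) • (a - b) + q‖ < R := by
      have := norm_add_le ((2 * c) • (a - b)) q
      linarith
    have h6 := hV a _ _ (show ‖(2 * c) • (a - b)‖ < R by linarith) hp2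
    have e2 : (2 * c) • (a - b) - ((2 * c) • (a - b) + q) = -q := by abel
    rw [e2, norm_neg] at h6
    have h7 := hmod b a ((2 * c) • (a - b)) (by linarith) (by rw [norm_sub_rev]; exact habδ)
    have h8 : V * ‖q‖ ≤ C * ‖q‖ := by gcongr
    linarith

/-- Theorem 1.4: exponential rate of convergence for convex Hamiltonians on `Ω_k = B(0,k)`. -/
theorem rate_exponential_convex {n : ℕ}
    (H : Euc n → Euc n → ℝ) (hHcont : Continuous (Function.uncurry H))
    (C₁ : ℝ) (hC₁ : 0 < C₁) (hH1 : ∀ x p : Euc n, -H x p ≤ C₁)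
    (C₂ : ℝ) (hC₂ : 0 < C₂) (hH2 : ∀ x : Euc n, |H x 0| ≤ C₂)
    (hH3b : ∀ R > (0:ℝ), ∃ ω : ℝ → ℝ, (∀ r, 0 ≤ ω r) ∧ MonotoneOn ω (Ici (0:ℝ)) ∧
      Tendsto ω (𝓝[>] (0:ℝ)) (𝓝 0) ∧
      ∀ x y p q : Euc n, ‖p‖ ≤ R → ‖q‖ ≤ R →
        |H x p - H y p| ≤ ω ‖x - y‖ ∧ |H x p - H x q| ≤ ω ‖p - q‖)
    (hH4 : ∀ M : ℝ, ∃ R : ℝ, ∀ p : Euc n, R ≤ ‖p‖ → ∀ x : Euc n, M ≤ H x p)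
    (hH5 : ∀ x : Euc n, ConvexOn ℝ univ (H x))
    (uk : ℕ → Euc n → ℝ) (Lip : ℝ≥0)
    (huk : ∀ k : ℕ, 1 ≤ k →
      IsStateConstraintSolution (ball (0 : Euc n) (k : ℝ)) H (uk k) ∧
      LipschitzOnWith Lip (uk k) (closure (ball (0 : Euc n) (k : ℝ))))
    (u : Euc n → ℝ) (M : ℝ) (hubd : ∀ x, |u x| ≤ M) (Lip' : ℝ≥0)
    (hulip : LipschitzWith Lip' u)
    (husol : IsViscositySubsolutionIn univ H u ∧ IsViscositySupersolutionOn univ H u) :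
    (∀ k : ℕ, 1 ≤ k → ∀ x ∈ closure (ball (0 : Euc n) (k : ℝ)), u x ≤ uk k x) ∧
    ∃ C > (0:ℝ),
      (∀ k : ℕ, 1 ≤ k → ∀ x ∈ ball (0 : Euc n) (k : ℝ),
        uk k x ≤ u x + C * Real.exp ((‖x‖ - (k : ℝ)) / C)) ∧
      (∀ R > (0:ℝ), ∀ k : ℕ, R < (k : ℝ) → ∀ x : Euc n, ‖x‖ ≤ R →
        0 ≤ uk k x - u x ∧ uk k x - u x ≤ (C * Real.exp (R / C)) * Real.exp (-(k : ℝ) / C)) := by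
  have hcl : ∀ k : ℕ, 1 ≤ k → closure (ball (0 : Euc n) (k : ℝ)) = closedBall 0 (k : ℝ) :=
    fun k hk => closure_ball _ (by positivity)
  have part1 : ∀ k : ℕ, 1 ≤ k → ∀ x ∈ closure (ball (0 : Euc n) (k : ℝ)), u x ≤ uk k x := by
    intro k hk x hx
    obtain ⟨⟨h1, h2, h3⟩, h4⟩ := huk k hk
    rw [hcl k hk] at h1 hx
    exact aux_lower H hH3b k (by positivity) (uk k) h1 h3 u Lip' hulip husol.1 x hx
  refine ⟨part1, ?_⟩
  have hM : 0 ≤ M := (abs_nonneg _).trans (hubd 0)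
  have hL0 : (0 : ℝ) ≤ Lip' := Lip'.2
  set A : ℝ := C₁ + M with hA
  have hA0 : 0 ≤ A := by positivity
  obtain ⟨V, hV0, hV⟩ := aux_lip H C₂ hH2 hH3b hH5 (2 * Lip' + A * Real.exp 1 + 1) (by positivity)
  set B : ℝ := 1 + V with hB
  have hB1 : 1 ≤ B := by linarith
  set C : ℝ := A * Real.exp 1 + B with hC
  have hAe : 0 ≤ A * Real.exp 1 := by positivity
  have hCB : B ≤ C := by linarith
  have hC0 : 0 < C := by linarith
  have part2 : ∀ k : ℕ, 1 ≤ k → ∀ x ∈ ball (0 : Euc n) (k : ℝ),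
        uk k x ≤ u x + C * Real.exp ((‖x‖ - (k : ℝ)) / C) := by
    intro k hk x hx
    obtain ⟨⟨h1, h2, h3⟩, h4⟩ := huk k hk
    rw [hcl k hk] at h4
    have h5 := aux_upper H C₁ hH1 hH3b Lip Lip' M A _ V B hA hA0 rfl hV hV0 hB1 (by linarith) k
      (by positivity) (uk k) h4 h2 u hubd hulip husol.2 x (ball_subset_closedBall hx)
    rw [mem_ball_zero_iff] at hx
    have hs1 : √(1 + ‖x‖ ^ 2) ≤ 1 + ‖x‖ := by
      rw [Real.sqrt_le_left (by positivity)]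
      nlinarith [norm_nonneg x]
    have h6 : (√(1 + ‖x‖ ^ 2) - k) / B ≤ 1 + (‖x‖ - k) / C := by
      have i1 : (√(1 + ‖x‖ ^ 2) - k) / B ≤ (1 + (‖x‖ - k)) / B := by
        gcongr; linarith
      have i2 : 1 / B ≤ 1 := by rw [div_le_one (by linarith)]; exact hB1
      have i3 : (k - ‖x‖) / C ≤ (k - ‖x‖) / B :=
        div_le_div_of_nonneg_left (by linarith) (by linarith) hCB
      have i4 : (‖x‖ - k) / B ≤ (‖x‖ - k) / C := by
        rw [← neg_sub (k : ℝ) ‖x‖, neg_div, neg_div]; linarith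
      rw [add_div] at i1
      linarith
    have h7 : A * Real.exp ((√(1 + ‖x‖ ^ 2) - k) / B) ≤ C * Real.exp ((‖x‖ - k) / C) := by
      calc A * Real.exp ((√(1 + ‖x‖ ^ 2) - k) / B)
          ≤ A * Real.exp (1 + (‖x‖ - k) / C) := by gcongr
        _ = (A * Real.exp 1) * Real.exp ((‖x‖ - k) / C) := by rw [Real.exp_add]; ring
        _ ≤ C * Real.exp ((‖x‖ - k) / C) := by gcongr; linarith
    linarith
  refine ⟨C, hC0, part2, ?_⟩
  intro R hR k hRk x hx
  have hk : 1 ≤ k := by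
    have : (0 : ℝ) < k := hR.trans hRk
    exact_mod_cast this
  have hxb : x ∈ ball (0 : Euc n) (k : ℝ) := by
    rw [mem_ball_zero_iff]; linarith
  have h1 := part1 k hk x (subset_closure hxb)
  have h2 := part2 k hk x hxb
  have h3 : C * Real.exp ((‖x‖ - k) / C) ≤ C * Real.exp (R / C) * Real.exp (-(k : ℝ) / C) := by
    rw [mul_assoc, ← Real.exp_add, ← add_div, ← sub_eq_add_neg]
    gcongr
  constructor <;> linarith
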